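/- arXiv:1206.6811 — 2 statements merged into one kernel-verified Lean document; each statement's English description precedes it below -/
import Mathlib

section
/- Let I be a finite index set with |I| = n, let A ∈ ℕ, and let {X_α}_{α∈I} be (possibly dependent) nonnegative integer-valued random variables with X_α ∈ {0,1,...,A} almost surely. Define p_α = P(X_α = 1), q_α = P(X_α ≥ 2), W = Σ_{α∈I} X_α, λ = Σ_{α∈I} p_α ∈ (0,∞), and q = Σ_{α∈I} q_α. For each α ∈ I let X'_α = 1{X_α = 1} and let B_α ⊆ I be a set with α ∈ B_α; define b'1 = Σ_{α∈I} Σ_{β∈B_α} p_α·p_β, b'2 = Σ_{α∈I} Σ_{β∈B_α, β≠α} E[X'_α·X'_β], and b'3 = Σ_{α∈I} E| E[X'_α − p_α | σ(X_β : β ∈ I∖B_α)] |. Set η_A = 2(b'1+b'2)·(1−e^{−λ})/λ + b'3·min{1, 1.4/√λ} + q and assume η_A < 1. Let M_A be an integer with M_A ≥ nA+2 and M_A ≥ 1/(1−η_A). Then |H(Po(λ)) − H(W)| ≤ η_A·log(M_A−1) + h(η_A) + μ(λ,M_A). -/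
open MeasureTheory ProbabilityTheory

/-- The Poisson probability mass function with mean `lam`. -/
noncomputable def poissonPmf (lam : ℝ) (k : ℕ) : ℝ :=
  Real.exp (-lam) * lam ^ k / (Nat.factorial k)

/-- The entropy (in nats) of a probability mass function on the nonnegative integers. -/
noncomputable def entropyPmf (P : ℕ → ℝ) : ℝ := -∑' k, P k * Real.log (P k)

/-- The binary entropy function (in nats). -/
noncomputable def binEnt (x : ℝ) : ℝ := -(x * Real.log x) - (1 - x) * Real.log (1 - x)

/-- The quantity `μ(λ, M)`. -/
noncomputable def muBound (lam M : ℝ) : ℝ :=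
  (max (lam * Real.log (Real.exp 1 / lam)) 0 + lam ^ 2 +
      (6 * Real.log (2 * Real.pi) + 1) / 12) *
    Real.exp (-(lam + (M - 2) * Real.log ((M - 2) / (lam * Real.exp 1))))

lemma poissonPmf_pos {lam : ℝ} (h : 0 < lam) (k : ℕ) : 0 < poissonPmf lam k := by
  unfold poissonPmf; positivity

lemma poissonPmf_succ (lam : ℝ) (k : ℕ) :
    ((k : ℝ) + 1) * poissonPmf lam (k + 1) = lam * poissonPmf lam k := by
  unfold poissonPmf
  rw [Nat.factorial_succ]
  push_cast
  field_simp
  ring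

lemma hasSum_poissonPmf (lam : ℝ) : HasSum (poissonPmf lam) 1 := by
  have h := (NormedSpace.expSeries_div_hasSum_exp (𝔸 := ℝ) lam).mul_left (Real.exp (-lam))
  rw [← Real.exp_eq_exp_ℝ, ← Real.exp_add, neg_add_cancel, Real.exp_zero] at h
  convert! h using 2 with k
  simp [poissonPmf, mul_div_assoc]

/-- The Poisson mass of `{0, …, k}`. -/
noncomputable def poissonCdf (lam : ℝ) (k : ℕ) : ℝ :=
  ∑ j ∈ Finset.range (k + 1), poissonPmf lam j

/-- The Poisson mass of `{k + 1, k + 2, …}`. -/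
noncomputable def poissonTail (lam : ℝ) (k : ℕ) : ℝ :=
  ∑' j, poissonPmf lam (j + (k + 1))

lemma summable_poissonPmf_add (lam : ℝ) (k : ℕ) :
    Summable fun j => poissonPmf lam (j + k) :=
  (summable_nat_add_iff k).2 (hasSum_poissonPmf lam).summable

lemma poissonCdf_add_poissonTail (lam : ℝ) (k : ℕ) :
    poissonCdf lam k + poissonTail lam k = 1 := by
  unfold poissonCdf poissonTail
  rw [(hasSum_poissonPmf lam).summable.sum_add_tsum_nat_add, (hasSum_poissonPmf lam).tsum_eq]

lemma poissonCdf_succ (lam : ℝ) (k : ℕ) :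
    poissonCdf lam (k + 1) = poissonCdf lam k + poissonPmf lam (k + 1) :=
  Finset.sum_range_succ _ _

lemma poissonTail_succ (lam : ℝ) (k : ℕ) :
    poissonTail lam k = poissonPmf lam (k + 1) + poissonTail lam (k + 1) := by
  have h1 := poissonCdf_add_poissonTail lam k
  have h2 := poissonCdf_add_poissonTail lam (k + 1)
  rw [poissonCdf_succ] at h2
  linarith

lemma poissonCdf_pos {lam : ℝ} (h : 0 < lam) (k : ℕ) : 0 < poissonCdf lam k :=
  Finset.sum_pos (fun _ _ => poissonPmf_pos h _) (by simp)

lemma poissonTail_pos {lam : ℝ} (h : 0 < lam) (k : ℕ) : 0 < poissonTail lam k :=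
  (summable_poissonPmf_add lam (k + 1)).tsum_pos (fun _ => (poissonPmf_pos h _).le) 0
    (poissonPmf_pos h _)

/-- Log-concavity of the Poisson mass function. -/
lemma poissonPmf_mul_le {lam : ℝ} (h : 0 < lam) {j k : ℕ} (hjk : j ≤ k) :
    poissonPmf lam j * poissonPmf lam (k + 1) ≤ poissonPmf lam (j + 1) * poissonPmf lam k := by
  have hj := poissonPmf_succ lam j
  have hk := poissonPmf_succ lam k
  have pj := poissonPmf_pos h j
  have pk := poissonPmf_pos h k
  have hj' : poissonPmf lam (j + 1) = lam * poissonPmf lam j / (j + 1) := by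
    field_simp; linarith
  have hk' : poissonPmf lam (k + 1) = lam * poissonPmf lam k / (k + 1) := by
    field_simp; linarith
  rw [hj', hk', mul_div_assoc', div_mul_eq_mul_div]
  have : (j : ℝ) ≤ k := by exact_mod_cast hjk
  rw [show poissonPmf lam j * (lam * poissonPmf lam k) = lam * poissonPmf lam j * poissonPmf lam k
    by ring]
  gcongr

lemma poissonCdf_mul_poissonPmf_succ_le {lam : ℝ} (h : 0 < lam) (k : ℕ) :
    poissonCdf lam k * poissonPmf lam (k + 1) ≤ poissonCdf lam (k + 1) * poissonPmf lam k := by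
  have h1 : poissonCdf lam k * poissonPmf lam (k + 1) ≤
      (∑ j ∈ Finset.range (k + 1), poissonPmf lam (j + 1)) * poissonPmf lam k := by
    unfold poissonCdf
    rw [Finset.sum_mul, Finset.sum_mul]
    refine Finset.sum_le_sum fun j hj => poissonPmf_mul_le h ?_
    have := Finset.mem_range.1 hj
    omega
  have h2 : poissonCdf lam (k + 1) =
      (∑ j ∈ Finset.range (k + 1), poissonPmf lam (j + 1)) + poissonPmf lam 0 :=
    Finset.sum_range_succ' _ _
  rw [h2, add_mul]
  linarith [mul_pos (poissonPmf_pos h 0) (poissonPmf_pos h k)]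

lemma poissonTail_succ_mul_poissonPmf_le {lam : ℝ} (h : 0 < lam) (k : ℕ) :
    poissonTail lam (k + 1) * poissonPmf lam k ≤ poissonTail lam k * poissonPmf lam (k + 1) := by
  unfold poissonTail
  rw [← tsum_mul_right, ← tsum_mul_right]
  refine Summable.tsum_le_tsum (fun j => ?_) ((summable_poissonPmf_add lam _).mul_right _)
    ((summable_poissonPmf_add lam _).mul_right _)
  have := poissonPmf_mul_le h (show k ≤ j + (k + 1) by omega)
  rw [show j + (k + 1 + 1) = j + (k + 1) + 1 by ring]
  linarith

lemma sub_mul_poissonCdf_le {lam : ℝ} (h : 0 < lam) (k : ℕ) :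
    (lam - k) * poissonCdf lam k ≤ lam * poissonPmf lam k := by
  rcases k with _ | k
  · simp [poissonCdf]
  · have h1 := poissonCdf_mul_poissonPmf_succ_le h k
    have h2 := poissonPmf_succ lam k
    have h3 := poissonCdf_succ lam k
    have p1 := poissonPmf_pos h k
    have h4 : lam * poissonCdf lam k ≤ (k + 1) * poissonCdf lam (k + 1) := by
      refine le_of_mul_le_mul_right ?_ p1
      calc lam * poissonCdf lam k * poissonPmf lam k
          = (k + 1) * (poissonCdf lam k * poissonPmf lam (k + 1)) := by
            linear_combination (-poissonCdf lam k) * h2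
        _ ≤ (k + 1) * (poissonCdf lam (k + 1) * poissonPmf lam k) := by gcongr
        _ = _ := by ring
    push_cast
    nlinarith

lemma sub_mul_poissonTail_le {lam : ℝ} (h : 0 < lam) (k : ℕ) :
    ((k : ℝ) + 1 - lam) * poissonTail lam k ≤ lam * poissonPmf lam k := by
  have h1 := poissonTail_succ_mul_poissonPmf_le h k
  have h2 := poissonPmf_succ lam k
  have h3 := poissonTail_succ lam k
  have p1 := poissonPmf_pos h k
  refine le_of_mul_le_mul_right ?_ p1
  have h4 : (k + 1) * (poissonTail lam (k + 1) * poissonPmf lam k) ≤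
    (k + 1) * (poissonTail lam k * poissonPmf lam (k + 1)) := by gcongr
  have e1 : ((k : ℝ) + 1) * (poissonTail lam k * poissonPmf lam (k + 1)) =
      lam * poissonTail lam k * poissonPmf lam k := by
    linear_combination poissonTail lam k * h2
  have e2 : ((k : ℝ) + 1) * (poissonTail lam (k + 1) * poissonPmf lam k) =
      (k + 1) * poissonTail lam k * poissonPmf lam k - lam * poissonPmf lam k * poissonPmf lam k := by
    rw [h3]; linear_combination (-poissonPmf lam k) * h2
  nlinarith

lemma poissonCdf_mul_poissonTail_le {lam : ℝ} (h : 0 < lam) (k : ℕ) :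
    poissonCdf lam k * poissonTail lam k ≤ lam * poissonPmf lam k := by
  have h1 := sub_mul_poissonCdf_le h k
  have h2 := sub_mul_poissonTail_le h k
  have h3 := poissonCdf_add_poissonTail lam k
  have p1 := poissonCdf_pos h k
  have p2 := poissonTail_pos h k
  have h4 := mul_le_mul_of_nonneg_right h1 p2.le
  have h5 := mul_le_mul_of_nonneg_right h2 p1.le
  have h6 : lam * poissonPmf lam k * poissonTail lam k +
      lam * poissonPmf lam k * poissonCdf lam k = lam * poissonPmf lam k := by
    linear_combination (lam * poissonPmf lam k) * h3
  nlinarith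

lemma factorial_le_stirling {k : ℕ} (hk : k ≠ 0) :
    (Nat.factorial k : ℝ) ≤ Real.exp 1 * Real.sqrt k * (k / Real.exp 1) ^ k := by
  obtain ⟨m, rfl⟩ := Nat.exists_eq_succ_of_ne_zero hk
  have h := Stirling.stirlingSeq'_antitone (Nat.zero_le m)
  simp only [Function.comp, Nat.succ_eq_add_one, zero_add, Stirling.stirlingSeq_one] at h
  unfold Stirling.stirlingSeq at h
  rw [div_le_iff₀ (by positivity)] at h
  refine h.trans (le_of_eq ?_)
  rw [Real.sqrt_mul (by norm_num)]
  field_simp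

lemma le_poissonPmf {lam : ℝ} (h : 0 < lam) {k : ℕ} (hk : k ≠ 0) :
    Real.exp (-1 - ((k : ℝ) - lam) ^ 2 / lam) ≤ poissonPmf lam k * Real.sqrt k := by
  have hk0 : (0 : ℝ) < k := by exact_mod_cast Nat.pos_of_ne_zero hk
  have h1 := factorial_le_stirling hk
  have h2 : Real.exp ((k : ℝ) - k ^ 2 / lam) ≤ (lam / k) ^ k := by
    have := Real.one_sub_inv_le_log_of_pos (div_pos h hk0)
    rw [← Real.exp_log (pow_pos (div_pos h hk0) k), Real.log_pow]
    refine Real.exp_le_exp.2 ?_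
    calc (k : ℝ) - k ^ 2 / lam = k * (1 - (lam / k)⁻¹) := by field_simp
      _ ≤ _ := by gcongr
  unfold poissonPmf
  rw [div_mul_eq_mul_div, le_div_iff₀ (by positivity)]
  calc Real.exp (-1 - ((k : ℝ) - lam) ^ 2 / lam) * (Nat.factorial k)
      ≤ Real.exp (-1 - ((k : ℝ) - lam) ^ 2 / lam) *
        (Real.exp 1 * Real.sqrt k * (k / Real.exp 1) ^ k) := by gcongr
    _ = Real.exp ((k : ℝ) - k ^ 2 / lam) * (Real.exp (-lam) * k ^ k * Real.sqrt k) := by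
      rw [div_pow, ← Real.exp_nat_mul, div_eq_mul_inv ((k : ℝ) ^ k), ← Real.exp_neg]
      have e : Real.exp (-1 - ((k : ℝ) - lam) ^ 2 / lam) * Real.exp 1 * Real.exp (-(k * 1)) =
          Real.exp ((k : ℝ) - k ^ 2 / lam) * Real.exp (-lam) := by
        rw [← Real.exp_add, ← Real.exp_add, ← Real.exp_add]
        congr 1
        field_simp
        ring
      linear_combination (k ^ k * Real.sqrt k) * e
    _ ≤ (lam / k) ^ k * (Real.exp (-lam) * k ^ k * Real.sqrt k) := by gcongr
    _ = _ := by
      rw [div_pow]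
      field_simp

lemma poissonCdf_mul_poissonTail_le_sqrt {lam : ℝ} (h : 0 < lam) (k : ℕ) :
    poissonCdf lam k * poissonTail lam k ≤ 1.4 * Real.sqrt lam * poissonPmf lam k := by
  set s := Real.sqrt lam with hs
  have hs0 : 0 < s := Real.sqrt_pos.2 h
  have hs2 : lam = s ^ 2 := (Real.sq_sqrt h.le).symm
  have F0 := poissonCdf_pos h k
  have G0 := poissonTail_pos h k
  have FG := poissonCdf_add_poissonTail lam k
  have p0 := poissonPmf_pos h k
  have key : ∀ t : ℝ, 0 ≤ t → ∀ d : ℝ, s ≤ 1.4 * d → d * t ≤ lam * poissonPmf lam k →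
      t ≤ 1.4 * s * poissonPmf lam k := by
    intro t ht0 d hd h1
    refine le_of_mul_le_mul_left ?_ hs0
    have : s * t ≤ 1.4 * d * t := by gcongr
    nlinarith
  rcases le_or_gt s 1.4 with hsmall | hbig
  · refine (poissonCdf_mul_poissonTail_le h k).trans ?_
    exact mul_le_mul_of_nonneg_right (by nlinarith) p0.le
  rcases le_or_gt s (1.4 * (lam - k)) with hc | hc
  · have := key (poissonCdf lam k) F0.le _ hc (sub_mul_poissonCdf_le h k)
    nlinarith
  rcases le_or_gt s (1.4 * ((k : ℝ) + 1 - lam)) with hd | hd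
  · have := key (poissonTail lam k) G0.le _ hd (sub_mul_poissonTail_le h k)
    nlinarith
  have hk : k ≠ 0 := by
    rintro rfl
    norm_num at hc
    nlinarith
  have hkpos : (0 : ℝ) < k := by exact_mod_cast Nat.pos_of_ne_zero hk
  have hP := le_poissonPmf h hk
  have hx : ((k : ℝ) - lam) ^ 2 / lam ≤ 0.5103 := by
    rw [div_le_iff₀ h, hs2]
    rw [hs2] at hc hd
    have : (1.4 * ((k : ℝ) - s ^ 2)) ^ 2 ≤ s ^ 2 := sq_le_sq' (by linarith) (by linarith)
    nlinarith
  have hsk : Real.sqrt k ≤ 1.1 * s := by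
    rw [Real.sqrt_le_left (by positivity)]
    rw [hs2] at hd
    nlinarith [sq_nonneg (s - 1.7)]
  have he : (0.2 : ℝ) ≤ Real.exp (-1 - ((k : ℝ) - lam) ^ 2 / lam) := by
    have h1 : Real.exp (-1.5103) ≤ Real.exp (-1 - ((k : ℝ) - lam) ^ 2 / lam) :=
      Real.exp_le_exp.2 (by linarith)
    refine le_trans ?_ h1
    have h2 : Real.exp (-1.5103) * Real.exp 1.5103 = 1 := by rw [← Real.exp_add]; norm_num
    have h3 : Real.exp 1.5103 ≤ 5 := by
      have h5 : Real.exp 1.5103 ^ 2 ≤ 25 := by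
        rw [← Real.exp_nat_mul]
        have h6 : Real.exp 1 ^ 3 < 20.1 := by
          have := Real.exp_one_lt_d9
          have h0 := Real.exp_pos 1
          calc Real.exp 1 ^ 3 < 2.7182818286 ^ 3 := by gcongr
            _ < _ := by norm_num
        have h7 : Real.exp 0.0206 ≤ 1.03 := by
          have := Real.exp_bound_div_one_sub_of_interval (x := 0.0206) (by norm_num) (by norm_num)
          exact this.trans (by norm_num)
        have h8 : Real.exp ((2 : ℕ) * 1.5103) = Real.exp 1 ^ 3 * Real.exp 0.0206 := by
          rw [← Real.exp_nat_mul, ← Real.exp_add]; norm_num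
        rw [h8]
        nlinarith [Real.exp_pos 0.0206]
      nlinarith [Real.exp_pos 1.5103]
    nlinarith [Real.exp_pos (-1.5103)]
  have h4 : poissonCdf lam k * poissonTail lam k ≤ 1 / 4 := by
    nlinarith [sq_nonneg (poissonCdf lam k - poissonTail lam k)]
  nlinarith

/-- The solution `f` of the Stein equation `λ f(k+1) - k f(k) = g(k) - E g(Z)`, `Z ~ Po(λ)`,
with `f 0 = 0`. -/
noncomputable def steinSol (lam : ℝ) (g : ℕ → ℝ) : ℕ → ℝ
  | 0 => 0
  | k + 1 => ((∑ j ∈ Finset.range (k + 1), g j * poissonPmf lam j) -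
      (∑' j, g j * poissonPmf lam j) * poissonCdf lam k) / (lam * poissonPmf lam k)

lemma steinSol_eq {lam : ℝ} (h : 0 < lam) (g : ℕ → ℝ) (k : ℕ) :
    lam * steinSol lam g (k + 1) - k * steinSol lam g k =
      g k - ∑' j, g j * poissonPmf lam j := by
  rcases k with _ | k
  · have p0 := poissonPmf_pos h 0
    simp only [steinSol, poissonCdf, zero_add, Finset.sum_range_one, Nat.cast_zero, zero_mul,
      sub_zero]
    field_simp
  · have p0 := poissonPmf_pos h k
    have p1 := poissonPmf_pos h (k + 1)
    have hr := poissonPmf_succ lam k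
    simp only [steinSol]
    rw [poissonCdf_succ, Finset.sum_range_succ (fun j => g j * poissonPmf lam j) (k + 1), ← hr]
    push_cast
    field_simp
    ring

lemma summable_mul_poissonPmf {lam : ℝ} (h : 0 < lam) {g : ℕ → ℝ} (g0 : ∀ k, 0 ≤ g k)
    (g1 : ∀ k, g k ≤ 1) : Summable fun j => g j * poissonPmf lam j :=
  Summable.of_nonneg_of_le (fun j => mul_nonneg (g0 j) (poissonPmf_pos h j).le)
    (fun j => mul_le_of_le_one_left (poissonPmf_pos h j).le (g1 j)) (hasSum_poissonPmf lam).summable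

lemma exists_steinSol_eq {lam : ℝ} (h : 0 < lam) {g : ℕ → ℝ} (g0 : ∀ k, 0 ≤ g k)
    (g1 : ∀ k, g k ≤ 1) : ∃ L R : ℕ → ℝ, (∀ k, 0 ≤ L k) ∧ (∀ k, L k ≤ poissonCdf lam k) ∧
      (∀ k, 0 ≤ R k) ∧ (∀ k, R k ≤ poissonTail lam k) ∧
      (∀ k, L (k + 1) = L k + g (k + 1) * poissonPmf lam (k + 1)) ∧
      (∀ k, R k = g (k + 1) * poissonPmf lam (k + 1) + R (k + 1)) ∧
      ∀ k, steinSol lam g (k + 1) =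
        (L k * poissonTail lam k - R k * poissonCdf lam k) / (lam * poissonPmf lam k) := by
  have hs := summable_mul_poissonPmf h g0 g1
  have hs' : ∀ k, Summable fun j => g (j + k) * poissonPmf lam (j + k) := fun k =>
    (summable_nat_add_iff k).2 hs
  have hsplit := fun k => hs.sum_add_tsum_nat_add (k + 1)
  refine ⟨fun k => ∑ j ∈ Finset.range (k + 1), g j * poissonPmf lam j,
    fun k => ∑' j, g (j + (k + 1)) * poissonPmf lam (j + (k + 1)),
    fun k => Finset.sum_nonneg fun j _ => mul_nonneg (g0 j) (poissonPmf_pos h j).le,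
    fun k => Finset.sum_le_sum fun j _ => mul_le_of_le_one_left (poissonPmf_pos h j).le (g1 j),
    fun k => tsum_nonneg fun j => mul_nonneg (g0 _) (poissonPmf_pos h _).le,
    fun k => (hs' _).tsum_le_tsum
      (fun j => mul_le_of_le_one_left (poissonPmf_pos h _).le (g1 _)) (summable_poissonPmf_add lam _),
    fun k => Finset.sum_range_succ _ _, fun k => ?_, fun k => ?_⟩
  · have h1 := hsplit k
    have h2 := hsplit (k + 1)
    rw [Finset.sum_range_succ] at h2
    dsimp only
    linarith
  · simp only [steinSol]
    congr 1
    rw [← hsplit k]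
    linear_combination
      (-∑ j ∈ Finset.range (k + 1), g j * poissonPmf lam j) * poissonCdf_add_poissonTail lam k

lemma abs_steinSol_le {lam : ℝ} (h : 0 < lam) {g : ℕ → ℝ} (g0 : ∀ k, 0 ≤ g k)
    (g1 : ∀ k, g k ≤ 1) (k : ℕ) : |steinSol lam g (k + 1)| ≤ min 1 (1.4 / Real.sqrt lam) := by
  obtain ⟨L, R, L0, L1, R0, R1, -, -, hf⟩ := exists_steinSol_eq h g0 g1
  have p0 := poissonPmf_pos h k
  have F0 := poissonCdf_pos h k
  have G0 := poissonTail_pos h k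
  have hs : 0 < Real.sqrt lam := Real.sqrt_pos.2 h
  have hle : |steinSol lam g (k + 1)| ≤
      poissonCdf lam k * poissonTail lam k / (lam * poissonPmf lam k) := by
    rw [hf, abs_div, abs_of_pos (mul_pos h p0)]
    gcongr
    have h1 := mul_le_mul_of_nonneg_right (L1 k) G0.le
    have h2 := mul_le_mul_of_nonneg_right (R1 k) F0.le
    have h3 := mul_nonneg (L0 k) G0.le
    have h4 := mul_nonneg (R0 k) F0.le
    rw [abs_le]
    constructor <;> linarith
  refine le_min (hle.trans ?_) (hle.trans ?_)
  · rw [div_le_one (by positivity)]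
    exact poissonCdf_mul_poissonTail_le h k
  · rw [div_le_div_iff₀ (by positivity) hs]
    have h1 := mul_le_mul_of_nonneg_right (poissonCdf_mul_poissonTail_le_sqrt h k) hs.le
    have h2 := Real.mul_self_sqrt h.le
    calc _ ≤ _ := h1
      _ = 1.4 * (Real.sqrt lam * Real.sqrt lam) * poissonPmf lam k := by ring
      _ = _ := by rw [h2]; ring

lemma mul_poissonCdf_le (lam : ℝ) (h : 0 < lam) (k : ℕ) :
    lam * poissonCdf lam k ≤ (k + 1) * (poissonCdf lam (k + 1) - poissonPmf lam 0) := by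
  have h2 : poissonCdf lam (k + 1) - poissonPmf lam 0 =
      ∑ j ∈ Finset.range (k + 1), poissonPmf lam (j + 1) := by
    unfold poissonCdf
    rw [Finset.sum_range_succ' _ (k + 1)]
    ring
  rw [h2, Finset.mul_sum, poissonCdf, Finset.mul_sum]
  refine Finset.sum_le_sum fun j hj => ?_
  rw [← poissonPmf_succ]
  have hj' : (j : ℝ) ≤ k := by
    have := Finset.mem_range.1 hj
    exact_mod_cast (by omega : j ≤ k)
  exact mul_le_mul_of_nonneg_right (by linarith) (poissonPmf_pos h _).le

lemma steinSol_succ_sub_le {lam : ℝ} (h : 0 < lam) {g : ℕ → ℝ} (g0 : ∀ k, 0 ≤ g k)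
    (g1 : ∀ k, g k ≤ 1) (k : ℕ) :
    steinSol lam g (k + 2) - steinSol lam g (k + 1) ≤ (1 - Real.exp (-lam)) / lam := by
  obtain ⟨L, R, L0, L1, R0, R1, hL, hR, hf⟩ := exists_steinSol_eq h g0 g1
  have p0 := poissonPmf_pos h k
  have p1 := poissonPmf_pos h (k + 1)
  have F0 := poissonCdf_pos h k
  have G0 := poissonTail_pos h (k + 1)
  have e0 : poissonPmf lam 0 = Real.exp (-lam) := by simp [poissonPmf]
  have hr := poissonPmf_succ lam k
  have hF : poissonCdf lam k / (lam * poissonPmf lam k) ≤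
      poissonCdf lam (k + 1) / (lam * poissonPmf lam (k + 1)) := by
    rw [div_le_div_iff₀ (by positivity) (by positivity)]
    nlinarith [poissonCdf_mul_poissonPmf_succ_le h k]
  have hG : poissonTail lam (k + 1) / (lam * poissonPmf lam (k + 1)) ≤
      poissonTail lam k / (lam * poissonPmf lam k) := by
    rw [div_le_div_iff₀ (by positivity) (by positivity)]
    nlinarith [poissonTail_succ_mul_poissonPmf_le h k]
  have hD : poissonTail lam (k + 1) / lam +
      poissonPmf lam (k + 1) * poissonCdf lam k / (lam * poissonPmf lam k) ≤
        (1 - Real.exp (-lam)) / lam := by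
    have hc := mul_poissonCdf_le lam h k
    rw [← e0, ← poissonCdf_add_poissonTail lam (k + 1), ← hr]
    have : poissonPmf lam (k + 1) * poissonCdf lam k / ((k + 1) * poissonPmf lam (k + 1)) =
      lam * poissonCdf lam k / (k + 1) / lam := by field_simp
    rw [this, ← add_div]
    refine div_le_div_of_nonneg_right ?_ h.le
    have : lam * poissonCdf lam k / (k + 1) ≤ poissonCdf lam (k + 1) - poissonPmf lam 0 := by
      rw [div_le_iff₀ (by positivity)]; linarith
    linarith
  have hD0 : 0 ≤ poissonTail lam (k + 1) / lam +
      poissonPmf lam (k + 1) * poissonCdf lam k / (lam * poissonPmf lam k) := by positivity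
  have hexp : steinSol lam g (k + 2) - steinSol lam g (k + 1) =
      L k * (poissonTail lam (k + 1) / (lam * poissonPmf lam (k + 1)) -
        poissonTail lam k / (lam * poissonPmf lam k)) +
      g (k + 1) * (poissonTail lam (k + 1) / lam +
        poissonPmf lam (k + 1) * poissonCdf lam k / (lam * poissonPmf lam k)) +
      R (k + 1) * (poissonCdf lam k / (lam * poissonPmf lam k) -
        poissonCdf lam (k + 1) / (lam * poissonPmf lam (k + 1))) := by
    rw [hf (k + 1), hf k, hL, hR k]
    field_simp
    ring
  rw [hexp]
  have t1 := mul_nonneg (L0 k) (sub_nonneg.2 hG)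
  have t2 := mul_nonneg (R0 (k + 1)) (sub_nonneg.2 hF)
  have t3 := mul_le_of_le_one_left hD0 (g1 (k + 1))
  linarith

lemma steinSol_one_sub {lam : ℝ} (h : 0 < lam) {g : ℕ → ℝ} (g0 : ∀ k, 0 ≤ g k)
    (g1 : ∀ k, g k ≤ 1) (k : ℕ) : steinSol lam (fun j => 1 - g j) k = -steinSol lam g k := by
  rcases k with _ | k
  · simp [steinSol]
  · simp only [steinSol, sub_mul, one_mul]
    rw [(hasSum_poissonPmf lam).summable.tsum_sub (summable_mul_poissonPmf h g0 g1),
      (hasSum_poissonPmf lam).tsum_eq, Finset.sum_sub_distrib, ← neg_div]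
    congr 1
    change poissonCdf lam k - _ - _ = _
    ring

lemma abs_steinSol_succ_sub_le {lam : ℝ} (h : 0 < lam) {g : ℕ → ℝ} (g0 : ∀ k, 0 ≤ g k)
    (g1 : ∀ k, g k ≤ 1) (k : ℕ) :
    |steinSol lam g (k + 2) - steinSol lam g (k + 1)| ≤ (1 - Real.exp (-lam)) / lam := by
  rw [abs_le]
  constructor
  · have := steinSol_succ_sub_le h (g := fun j => 1 - g j) (fun j => sub_nonneg.2 (g1 j))
      (fun j => sub_le_self _ (g0 j)) k
    rw [steinSol_one_sub h g0 g1, steinSol_one_sub h g0 g1] at this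
    linarith
  · exact steinSol_succ_sub_le h g0 g1 k

lemma abs_steinSol_add_sub_le {lam : ℝ} (h : 0 < lam) {g : ℕ → ℝ} (g0 : ∀ k, 0 ≤ g k)
    (g1 : ∀ k, g k ≤ 1) (k d : ℕ) :
    |steinSol lam g (k + d + 1) - steinSol lam g (k + 1)| ≤
      d * ((1 - Real.exp (-lam)) / lam) := by
  induction d with
  | zero => simp
  | succ d ih =>
    have h1 := abs_steinSol_succ_sub_le h g0 g1 (k + d)
    have h2 := abs_sub_le (steinSol lam g (k + (d + 1) + 1)) (steinSol lam g (k + d + 1))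
      (steinSol lam g (k + 1))
    have h3 : k + (d + 1) + 1 = k + d + 2 := by ring
    rw [h3] at h2 ⊢
    push_cast
    linarith

/-- If `J` is a coupling of the mass functions `P` and `Q`, and `K` is a family of (sub)probability
mass functions, then the conditional entropy is at most the cross entropy with respect to `K`. -/
lemma sum_negMulLog_sub_le_of_coupling {ι : Type*} (s : Finset ι) (P Q : ι → ℝ) (J K : ι → ι → ℝ)
    (hJ : ∀ x ∈ s, ∀ y ∈ s, 0 ≤ J x y) (hJP : ∀ x ∈ s, ∑ y ∈ s, J x y = P x)
    (hJQ : ∀ y ∈ s, ∑ x ∈ s, J x y = Q y) (hP1 : ∑ x ∈ s, P x = 1) (hQ1 : ∑ y ∈ s, Q y = 1)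
    (hK : ∀ x ∈ s, ∀ y ∈ s, 0 < K x y) (hK1 : ∀ y ∈ s, ∑ x ∈ s, K x y ≤ 1) :
    ∑ x ∈ s, Real.negMulLog (P x) - ∑ y ∈ s, Real.negMulLog (Q y) ≤
      -∑ x ∈ s, ∑ y ∈ s, J x y * Real.log (K x y) := by
  have hQ0 : ∀ y ∈ s, 0 ≤ Q y := fun y hy =>
    hJQ y hy ▸ Finset.sum_nonneg fun x hx => hJ x hx y hy
  have hJle : ∀ x ∈ s, ∀ y ∈ s, J x y ≤ P x := fun x hx y hy =>
    hJP x hx ▸ Finset.single_le_sum (f := J x) (fun y hy => hJ x hx y hy) hy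
  have hJle' : ∀ x ∈ s, ∀ y ∈ s, J x y ≤ Q y := fun x hx y hy =>
    hJQ y hy ▸ Finset.single_le_sum (f := fun x => J x y) (fun x hx => hJ x hx y hy) hx
  have hpt : ∀ x ∈ s, ∀ y ∈ s,
      J x y * (-Real.log (P x)) + J x y * Real.log (Q y) + J x y * Real.log (K x y) ≤
        Q y * K x y - J x y := by
    intro x hx y hy
    rcases (hJ x hx y hy).eq_or_lt with h0 | h0
    · rw [← h0]
      have := mul_nonneg (hQ0 y hy) (hK x hx y hy).le
      linarith
    · have hPx := h0.trans_le (hJle x hx y hy)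
      have hQy := h0.trans_le (hJle' x hx y hy)
      have hKp := hK x hx y hy
      have hlog := Real.log_le_sub_one_of_pos (div_pos (mul_pos hQy hKp) hPx)
      rw [Real.log_div (by positivity) hPx.ne', Real.log_mul hQy.ne' hKp.ne'] at hlog
      have h1 : J x y * (Q y * K x y / P x) ≤ Q y * K x y := by
        rw [mul_div_assoc', div_le_iff₀ hPx, mul_comm (Q y * K x y)]
        exact mul_le_mul_of_nonneg_right (hJle x hx y hy) (by positivity)
      nlinarith [mul_le_mul_of_nonneg_left hlog h0.le]
  have hsum := Finset.sum_le_sum fun x hx => Finset.sum_le_sum fun y hy => hpt x hx y hy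
  simp only [Finset.sum_add_distrib, Finset.sum_sub_distrib] at hsum
  have e1 : ∑ x ∈ s, ∑ y ∈ s, J x y * (-Real.log (P x)) = ∑ x ∈ s, Real.negMulLog (P x) := by
    refine Finset.sum_congr rfl fun x hx => ?_
    rw [← Finset.sum_mul, hJP x hx, Real.negMulLog]
    ring
  have e2 : ∑ x ∈ s, ∑ y ∈ s, J x y * Real.log (Q y) = -∑ y ∈ s, Real.negMulLog (Q y) := by
    rw [Finset.sum_comm, ← Finset.sum_neg_distrib]
    refine Finset.sum_congr rfl fun y hy => ?_
    rw [← Finset.sum_mul, hJQ y hy, Real.negMulLog]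
    ring
  have e3 : ∑ x ∈ s, ∑ y ∈ s, J x y = 1 := (Finset.sum_congr rfl hJP).trans hP1
  have e4 : ∑ x ∈ s, ∑ y ∈ s, Q y * K x y ≤ 1 := by
    rw [Finset.sum_comm, ← hQ1]
    refine Finset.sum_le_sum fun y hy => ?_
    rw [← Finset.mul_sum]
    exact mul_le_of_le_one_right (hQ0 y hy) (hK1 y hy)
  linarith

lemma sum_negMulLog_sub_le {ι : Type*} [DecidableEq ι] (s : Finset ι) (P Q : ι → ℝ)
    (hP0 : ∀ x ∈ s, 0 ≤ P x) (hQ0 : ∀ x ∈ s, 0 ≤ Q x)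
    (hP1 : ∑ x ∈ s, P x = 1) (hQ1 : ∑ x ∈ s, Q x = 1) (hcard : 2 ≤ s.card) {η : ℝ} (hη1 : η < 1)
    (hη : 1 / (1 - η) ≤ (s.card : ℝ)) (hPQ : ∑ x ∈ s, max (P x - Q x) 0 ≤ η) :
    ∑ x ∈ s, Real.negMulLog (P x) - ∑ x ∈ s, Real.negMulLog (Q x) ≤
      η * Real.log ((s.card : ℝ) - 1) + binEnt η := by
  set M : ℝ := (s.card : ℝ) with hM
  have hM2 : (2 : ℝ) ≤ M := by rw [hM]; exact_mod_cast hcard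
  set U : ι → ℝ := fun x => max (P x - Q x) 0 with hU
  set V : ι → ℝ := fun x => max (Q x - P x) 0 with hV
  set δ := ∑ x ∈ s, U x with hδ
  have hU0 : ∀ x, 0 ≤ U x := fun x => le_max_right _ _
  have hV0 : ∀ x, 0 ≤ V x := fun x => le_max_right _ _
  have hmin : ∀ x, min (P x) (Q x) + U x = P x := fun x => by
    simp only [hU]; rcases le_total (P x) (Q x) with h | h <;> simp [h]
  have hmin' : ∀ x, min (P x) (Q x) + V x = Q x := fun x => by
    simp only [hV]; rcases le_total (P x) (Q x) with h | h <;> simp [h]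
  have hUV : ∀ x, U x * V x = 0 := fun x => by
    simp only [hU, hV]; rcases le_total (P x) (Q x) with h | h <;> simp [h]
  have hR : ∑ x ∈ s, min (P x) (Q x) = 1 - δ := by
    have := Finset.sum_congr (rfl : s = s) fun x _ => hmin x
    rw [Finset.sum_add_distrib, hP1] at this
    linarith
  have hVδ : ∑ x ∈ s, V x = δ := by
    have := Finset.sum_congr (rfl : s = s) fun x _ => hmin' x
    rw [Finset.sum_add_distrib, hQ1] at this
    linarith
  have hδ0 : 0 ≤ δ := Finset.sum_nonneg fun x _ => hU0 x
  rcases (hδ0.trans hPQ).eq_or_lt with h0 | h0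
  · have hδz : δ = 0 := le_antisymm (h0 ▸ hPQ) hδ0
    have hUz := (Finset.sum_eq_zero_iff_of_nonneg fun x _ => hU0 x).1 hδz
    have hVz := (Finset.sum_eq_zero_iff_of_nonneg fun x _ => hV0 x).1 (hVδ.trans hδz)
    have : ∑ x ∈ s, Real.negMulLog (P x) = ∑ x ∈ s, Real.negMulLog (Q x) :=
      Finset.sum_congr rfl fun x hx => by
        rw [← hmin x, ← hmin' x, hUz x hx, hVz x hx]
        simp
    rw [this, ← h0]
    simp [binEnt]
  have hUδ : ∀ x ∈ s, U x * δ / δ = U x := fun x hx => by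
    rcases hδ0.eq_or_lt with h | h
    · rw [(Finset.sum_eq_zero_iff_of_nonneg fun x _ => hU0 x).1 h.symm x hx]; simp
    · field_simp
  have hVδ' : ∀ x ∈ s, δ * V x / δ = V x := fun x hx => by
    rcases hδ0.eq_or_lt with h | h
    · rw [(Finset.sum_eq_zero_iff_of_nonneg fun x _ => hV0 x).1 (hVδ.trans h.symm) x hx]; simp
    · field_simp
  set J : ι → ι → ℝ := fun x y => (if x = y then min (P x) (Q x) else 0) + U x * V y / δ with hJ
  set K : ι → ι → ℝ := fun x y => if x = y then 1 - η else η / (M - 1) with hK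
  have hKlog : ∀ x y, J x y * Real.log (K x y) =
      (if x = y then min (P x) (Q x) * (Real.log (1 - η)) else 0) +
        U x * V y / δ * Real.log (η / (M - 1)) := by
    intro x y
    simp only [hJ, hK]
    split_ifs with h
    · subst h; rw [hUV]; simp
    · simp
  have hJP : ∀ x ∈ s, ∑ y ∈ s, J x y = P x := fun x hx => by
    simp only [hJ]
    rw [Finset.sum_add_distrib, Finset.sum_ite_eq s x, if_pos hx, ← Finset.sum_div,
      ← Finset.mul_sum, hVδ, hUδ x hx, hmin]
  have hJQ : ∀ y ∈ s, ∑ x ∈ s, J x y = Q y := fun y hy => by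
    simp only [hJ]
    rw [Finset.sum_add_distrib, Finset.sum_ite_eq' s y, if_pos hy, ← Finset.sum_div,
      ← Finset.sum_mul, ← hδ, hVδ' y hy, hmin']
  have hmain := sum_negMulLog_sub_le_of_coupling s P Q J K
    (fun x hx y hy => add_nonneg (by split_ifs <;> simp [hP0 x hx, hQ0 x hx])
      (div_nonneg (mul_nonneg (hU0 x) (hV0 y)) hδ0)) hJP hJQ hP1 hQ1
    (fun x _ y _ => by
      simp only [hK]
      split_ifs
      · linarith
      · exact div_pos h0 (by linarith))
    (fun y hy => by
      simp only [hK]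
      rw [Finset.sum_ite, Finset.filter_eq' s y, if_pos hy, Finset.filter_ne' s y,
        Finset.sum_const, Finset.sum_const, Finset.card_singleton, Finset.card_erase_of_mem hy,
        one_smul, nsmul_eq_mul, Nat.cast_sub (by omega), Nat.cast_one, ← hM]
      have : M - 1 ≠ 0 := by linarith
      field_simp
      linarith)
  have hval : ∑ x ∈ s, ∑ y ∈ s, J x y * Real.log (K x y) =
      (1 - δ) * Real.log (1 - η) + δ * Real.log (η / (M - 1)) := by
    simp_rw [hKlog, Finset.sum_add_distrib, ← Finset.sum_mul]
    congr 1
    · rw [← hR, Finset.sum_mul]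
      exact Finset.sum_congr rfl fun x hx => by rw [Finset.sum_ite_eq s x, if_pos hx]
    · congr 1
      exact Finset.sum_congr rfl fun x hx => by
        rw [← Finset.sum_div, ← Finset.mul_sum, hVδ, hUδ x hx]
  rw [hval] at hmain
  refine hmain.trans ?_
  have hmono : Real.log (η / (M - 1)) ≤ Real.log (1 - η) := by
    refine Real.log_le_log (div_pos h0 (by linarith)) ?_
    rw [div_le_iff₀ (by linarith)] at hη ⊢
    linarith
  have hlog : Real.log (η / (M - 1)) = Real.log η - Real.log (M - 1) :=
    Real.log_div h0.ne' (by linarith)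
  have h1 : (η - δ) * Real.log (η / (M - 1)) ≤ (η - δ) * Real.log (1 - η) :=
    mul_le_mul_of_nonneg_left hmono (by linarith)
  rw [hlog] at h1 ⊢
  unfold binEnt
  linarith

lemma abs_sum_negMulLog_sub_le {ι : Type*} [DecidableEq ι] (s : Finset ι) (P Q : ι → ℝ)
    (hP0 : ∀ x ∈ s, 0 ≤ P x) (hQ0 : ∀ x ∈ s, 0 ≤ Q x)
    (hP1 : ∑ x ∈ s, P x = 1) (hQ1 : ∑ x ∈ s, Q x = 1) (hcard : 2 ≤ s.card) {η : ℝ} (hη1 : η < 1)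
    (hη : 1 / (1 - η) ≤ (s.card : ℝ)) (hPQ : ∑ x ∈ s, max (P x - Q x) 0 ≤ η) :
    |∑ x ∈ s, Real.negMulLog (P x) - ∑ x ∈ s, Real.negMulLog (Q x)| ≤
      η * Real.log ((s.card : ℝ) - 1) + binEnt η := by
  have hQP : ∑ x ∈ s, max (Q x - P x) 0 ≤ η := by
    have h : ∑ x ∈ s, (max (Q x - P x) 0 - max (P x - Q x) 0) = ∑ x ∈ s, (Q x - P x) :=
      Finset.sum_congr rfl fun x _ => by
        rcases le_total (P x) (Q x) with h | h <;> simp [h]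
    rw [Finset.sum_sub_distrib, Finset.sum_sub_distrib, hP1, hQ1] at h
    linarith
  rw [abs_le]
  constructor
  · linarith [sum_negMulLog_sub_le s Q P hQ0 hP0 hQ1 hP1 hcard hη1 hη hQP]
  · exact sum_negMulLog_sub_le s P Q hP0 hQ0 hP1 hQ1 hcard hη1 hη hPQ

/-- Change of mean from `lam` to `m ≥ lam` beyond the level `m`. -/
lemma poissonPmf_add_le {lam : ℝ} (h : 0 < lam) {m : ℕ} (hm : lam ≤ m) (j : ℕ) :
    poissonPmf lam (j + m) ≤
      (lam / m) ^ m * Real.exp (m - lam) * poissonPmf m (j + m) := by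
  have hm0 : (0 : ℝ) < m := h.trans_le hm
  unfold poissonPmf
  rw [mul_div_assoc', Real.exp_sub, Real.exp_neg, Real.exp_neg, pow_add, pow_add, div_pow]
  refine div_le_div_of_nonneg_right ?_ (by positivity)
  have : lam ^ j ≤ (m : ℝ) ^ j := by gcongr
  calc (Real.exp lam)⁻¹ * (lam ^ j * lam ^ m) ≤ (Real.exp lam)⁻¹ * ((m : ℝ) ^ j * lam ^ m) := by
        gcongr
    _ = _ := by field_simp

lemma tsum_poissonPmf_add_le {lam : ℝ} (h : 0 < lam) {m : ℕ} (hm : lam ≤ m) :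
    ∑' j, poissonPmf lam (j + m) ≤ (lam / m) ^ m * Real.exp (m - lam) := by
  have hm0 : (0 : ℝ) < m := h.trans_le hm
  calc ∑' j, poissonPmf lam (j + m)
      ≤ ∑' j, (lam / m) ^ m * Real.exp (m - lam) * poissonPmf m (j + m) :=
        (summable_poissonPmf_add lam m).tsum_le_tsum (poissonPmf_add_le h hm)
          ((summable_poissonPmf_add m m).mul_left _)
    _ = (lam / m) ^ m * Real.exp (m - lam) * ∑' j, poissonPmf m (j + m) := tsum_mul_left
    _ ≤ (lam / m) ^ m * Real.exp (m - lam) * 1 := by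
        gcongr
        rw [← (hasSum_poissonPmf m).tsum_eq,
          ← (hasSum_poissonPmf m).summable.sum_add_tsum_nat_add m]
        exact le_add_of_nonneg_left (Finset.sum_nonneg fun _ _ => (poissonPmf_pos hm0 _).le)
    _ = _ := mul_one _

lemma two_mul_sqrt_mul_poissonPmf_le {lam : ℝ} (h : 0 < lam) {m : ℕ} (hm : lam ≤ m) :
    2 * Real.sqrt m * poissonPmf lam m ≤ (lam / m) ^ m * Real.exp (m - lam) := by
  have hm0 : (0 : ℝ) < m := h.trans_le hm
  have h1 := poissonPmf_add_le h hm 0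
  rw [zero_add] at h1
  have h2 : 2 * Real.sqrt m * poissonPmf m m ≤ 1 := by
    have h3 := Stirling.le_factorial_stirling m
    have h4 : 2 * Real.sqrt m ≤ Real.sqrt (2 * Real.pi * m) := by
      rw [Real.sqrt_mul (by positivity)]
      gcongr
      refine Real.le_sqrt_of_sq_le ?_
      nlinarith [Real.pi_gt_three]
    unfold poissonPmf
    rw [mul_div_assoc', div_le_one (by positivity)]
    refine le_trans ?_ h3
    rw [div_pow, ← Real.exp_nat_mul, mul_one, Real.exp_neg]
    calc 2 * Real.sqrt m * ((Real.exp m)⁻¹ * m ^ m)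
        ≤ Real.sqrt (2 * Real.pi * m) * ((Real.exp m)⁻¹ * m ^ m) := by gcongr
      _ = _ := by field_simp
  have h5 : 0 ≤ (lam / m) ^ m * Real.exp (m - lam) := by positivity
  calc 2 * Real.sqrt m * poissonPmf lam m
      ≤ 2 * Real.sqrt m * ((lam / m) ^ m * Real.exp (m - lam) * poissonPmf m m) := by gcongr
    _ = (lam / m) ^ m * Real.exp (m - lam) * (2 * Real.sqrt m * poissonPmf m m) := by ring
    _ ≤ _ := mul_le_of_le_one_right h5 h2

lemma log_factorial_le (k : ℕ) :
    Real.log (Nat.factorial (k + 2)) ≤ ((k : ℝ) + 2) * (k + 1) / 2 := by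
  induction k with
  | zero =>
    have := Real.log_le_sub_one_of_pos (show (0 : ℝ) < 2 by norm_num)
    norm_num [Nat.factorial] at this ⊢
    linarith
  | succ k ih =>
    have h : ((Nat.factorial (k + 1 + 2) : ℕ) : ℝ) = ((k : ℝ) + 3) * (Nat.factorial (k + 2) : ℕ) := by
      rw [show k + 1 + 2 = (k + 2) + 1 by ring, Nat.factorial_succ]
      push_cast
      ring
    rw [h, Real.log_mul (by positivity) (by positivity)]
    have := Real.log_le_sub_one_of_pos (show (0 : ℝ) < k + 3 by positivity)
    push_cast
    linarith

lemma log_factorial_succ_le (m : ℕ) :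
    Real.log (Nat.factorial (m + 1)) ≤ (m + 1) * (2 * Real.sqrt m) := by
  have hs := Real.sqrt_nonneg m
  have h1 : Real.log (Nat.factorial (m + 1)) ≤ (m + 1) * Real.log ((m : ℝ) + 1) := by
    have : ((Nat.factorial (m + 1) : ℕ) : ℝ) ≤ ((m : ℝ) + 1) ^ (m + 1) := by
      exact_mod_cast Nat.factorial_le_pow (m + 1)
    have h2 := Real.log_le_log (by positivity) this
    rw [Real.log_pow] at h2
    exact_mod_cast h2
  refine h1.trans (mul_le_mul_of_nonneg_left ?_ (by positivity))
  have h3 : (m : ℝ) + 1 ≤ (1 + Real.sqrt m) ^ 2 := by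
    nlinarith [Real.sq_sqrt (Nat.cast_nonneg (α := ℝ) m)]
  have h4 := Real.log_le_log (by positivity) h3
  rw [Real.log_pow] at h4
  have h5 := Real.log_le_sub_one_of_pos (show 0 < 1 + Real.sqrt m by positivity)
  push_cast at h4
  linarith

lemma negMulLog_poissonPmf_succ {lam : ℝ} (h : 0 < lam) (k : ℕ) :
    Real.negMulLog (poissonPmf lam (k + 1)) =
      lam * poissonPmf lam (k + 1) - lam * Real.log lam * poissonPmf lam k +
        poissonPmf lam (k + 1) * Real.log (Nat.factorial (k + 1)) := by
  have hlog : Real.log (poissonPmf lam (k + 1)) =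
      -lam + (k + 1) * Real.log lam - Real.log (Nat.factorial (k + 1)) := by
    unfold poissonPmf
    rw [Real.log_div (by positivity) (by positivity), Real.log_mul (by positivity) (by positivity),
      Real.log_exp, Real.log_pow]
    push_cast
    ring
  rw [Real.negMulLog, hlog]
  linear_combination (-Real.log lam) * poissonPmf_succ lam k

lemma poissonPmf_succ_mul_log_factorial_le {lam : ℝ} (h : 0 < lam) (m : ℕ) :
    poissonPmf lam (m + 1) * Real.log (Nat.factorial (m + 1)) ≤
      lam * (2 * Real.sqrt m * poissonPmf lam m) := by
  calc _ ≤ poissonPmf lam (m + 1) * ((m + 1) * (2 * Real.sqrt m)) :=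
        mul_le_mul_of_nonneg_left (log_factorial_succ_le m) (poissonPmf_pos h _).le
    _ = _ := by linear_combination (2 * Real.sqrt m) * poissonPmf_succ lam m

lemma poissonPmf_add_two_mul_log_factorial_le {lam : ℝ} (h : 0 < lam) (k : ℕ) :
    poissonPmf lam (k + 2) * Real.log (Nat.factorial (k + 2)) ≤
      lam ^ 2 / 2 * poissonPmf lam k := by
  have h1 := poissonPmf_succ lam k
  have h2 := poissonPmf_succ lam (k + 1)
  push_cast at h2
  calc _ ≤ poissonPmf lam (k + 2) * (((k : ℝ) + 2) * (k + 1) / 2) :=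
        mul_le_mul_of_nonneg_left (log_factorial_le k) (poissonPmf_pos h _).le
    _ = _ := by linear_combination ((k : ℝ) + 1) / 2 * h2 + lam / 2 * h1

lemma poissonPmf_le_one {lam : ℝ} (h : 0 < lam) (k : ℕ) : poissonPmf lam k ≤ 1 :=
  le_hasSum (hasSum_poissonPmf lam) k fun _ _ => (poissonPmf_pos h _).le

lemma summable_negMulLog_poissonPmf {lam : ℝ} (h : 0 < lam) :
    Summable fun k => Real.negMulLog (poissonPmf lam k) := by
  rw [← summable_nat_add_iff 2]
  refine Summable.of_nonneg_of_le
    (fun k => Real.negMulLog_nonneg (poissonPmf_pos h _).le (poissonPmf_le_one h _))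
    (fun k => ?_) ((((summable_poissonPmf_add lam 2).mul_left lam).sub
      ((summable_poissonPmf_add lam 1).mul_left (lam * Real.log lam))).add
      ((hasSum_poissonPmf lam).summable.mul_left (lam ^ 2 / 2)))
  rw [negMulLog_poissonPmf_succ h (k + 1)]
  exact add_le_add le_rfl (poissonPmf_add_two_mul_log_factorial_le h k)

lemma exp_neg_add_mul_log {lam : ℝ} (h : 0 < lam) {m : ℕ} (hm : lam ≤ m) :
    Real.exp (-(lam + m * Real.log (m / (lam * Real.exp 1)))) =
      (lam / m) ^ m * Real.exp (m - lam) := by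
  have hm0 : (0 : ℝ) < m := h.trans_le hm
  rw [← Real.exp_log (pow_pos (div_pos h hm0) m), ← Real.exp_add, Real.log_pow,
    Real.log_div h.ne' hm0.ne', Real.log_div hm0.ne' (by positivity),
    Real.log_mul h.ne' (Real.exp_pos 1).ne', Real.log_exp]
  congr 1
  ring

lemma tsum_negMulLog_poissonPmf_le {lam : ℝ} (h : 0 < lam) {m : ℕ} (hm : lam ≤ m) :
    ∑' j, Real.negMulLog (poissonPmf lam (j + (m + 1))) ≤ muBound lam ((m : ℝ) + 2) := by
  have hm0 : (0 : ℝ) < m := h.trans_le hm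
  have hS := (summable_nat_add_iff (m + 1)).2 (summable_negMulLog_poissonPmf h)
  set C := (lam / m) ^ m * Real.exp (m - lam) with hC
  have hC0 : 0 ≤ C := by positivity
  set T := ∑' j, poissonPmf lam (j + m) with hT
  have hTC : T ≤ C := tsum_poissonPmf_add_le h hm
  have hT0 : 0 ≤ T := tsum_nonneg fun _ => (poissonPmf_pos h _).le
  have hTtail : poissonTail lam m ≤ T := by
    rw [hT, (summable_poissonPmf_add lam m).tsum_eq_zero_add, poissonTail]
    simp only [zero_add, add_assoc, add_comm 1 m]
    exact le_add_of_nonneg_left (poissonPmf_pos h _).le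
  have hP := two_mul_sqrt_mul_poissonPmf_le h hm
  set w : ℕ → ℝ := fun j => poissonPmf lam (j + (m + 1)) * Real.log (Nat.factorial (j + (m + 1)))
    with hw
  have hS1 := (summable_poissonPmf_add lam (m + 1)).mul_left lam
  have hS2 := (summable_poissonPmf_add lam m).mul_left (lam * Real.log lam)
  have hterm : ∀ j, Real.negMulLog (poissonPmf lam (j + (m + 1))) =
      lam * poissonPmf lam (j + (m + 1)) - lam * Real.log lam * poissonPmf lam (j + m) + w j :=
    fun j => negMulLog_poissonPmf_succ h (j + m)
  have hSw : Summable w := by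
    refine (hS.sub (hS1.sub hS2)).congr fun j => ?_
    rw [hterm]
    ring
  have hwsum : ∑' j, w j ≤ lam * C + lam ^ 2 / 2 * C := by
    rw [hSw.tsum_eq_zero_add]
    refine add_le_add ?_ ?_
    · simp only [hw, zero_add]
      exact (poissonPmf_succ_mul_log_factorial_le h m).trans (by gcongr)
    · calc ∑' j, w (j + 1) ≤ ∑' j, lam ^ 2 / 2 * poissonPmf lam (j + m) := by
            refine ((summable_nat_add_iff 1).2 hSw).tsum_le_tsum (fun j => ?_)
              ((summable_poissonPmf_add lam m).mul_left _)
            have := poissonPmf_add_two_mul_log_factorial_le h (j + m)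
            simp only [hw]
            rwa [show j + 1 + (m + 1) = j + m + 2 by ring]
        _ = lam ^ 2 / 2 * T := tsum_mul_left
        _ ≤ _ := by gcongr
  have hmain : ∑' j, Real.negMulLog (poissonPmf lam (j + (m + 1))) =
      lam * poissonTail lam m - lam * Real.log lam * T + ∑' j, w j := by
    rw [tsum_congr hterm, (hS1.sub hS2).tsum_add hSw, hS1.tsum_sub hS2, tsum_mul_left,
      tsum_mul_left]
    rfl
  have hconst : 1 / 2 ≤ (6 * Real.log (2 * Real.pi) + 1) / 12 := by
    have h1 : 1 ≤ Real.log (2 * Real.pi) := by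
      rw [Real.le_log_iff_exp_le (by positivity)]
      linarith [Real.exp_one_lt_d9, Real.pi_gt_three]
    linarith
  have hmax : lam * poissonTail lam m - lam * Real.log lam * T ≤
      max (lam * Real.log (Real.exp 1 / lam)) 0 * C := by
    have h1 : lam * Real.log (Real.exp 1 / lam) = lam - lam * Real.log lam := by
      rw [Real.log_div (Real.exp_pos 1).ne' h.ne', Real.log_exp]
      ring
    calc _ ≤ lam * T - lam * Real.log lam * T := by gcongr
      _ = lam * Real.log (Real.exp 1 / lam) * T := by rw [h1]; ring
      _ ≤ max (lam * Real.log (Real.exp 1 / lam)) 0 * T := by gcongr; exact le_max_left _ _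
      _ ≤ _ := by gcongr
  rw [hmain, muBound, add_sub_cancel_right, exp_neg_add_mul_log h hm, ← hC]
  nlinarith [mul_nonneg (sq_nonneg (lam - 1)) hC0, mul_le_mul_of_nonneg_right hconst hC0]

/-- Lumping the Poisson masses above `m` into one atom changes the entropy by at most
`muBound`. -/
lemma abs_entropyPmf_poissonPmf_sub_le {lam : ℝ} (h : 0 < lam) {m : ℕ} (hm : lam ≤ m) :
    |entropyPmf (poissonPmf lam) - (∑ k ∈ Finset.range (m + 1),
      Real.negMulLog (poissonPmf lam k) + Real.negMulLog (poissonTail lam m))| ≤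
        muBound lam ((m : ℝ) + 2) := by
  have hS := summable_negMulLog_poissonPmf h
  have he : entropyPmf (poissonPmf lam) = ∑' k, Real.negMulLog (poissonPmf lam k) := by
    simp only [entropyPmf, Real.negMulLog, neg_mul, tsum_neg]
  have hG0 := poissonTail_pos h m
  have hG1 : poissonTail lam m ≤ 1 := by
    linarith [poissonCdf_add_poissonTail lam m, poissonCdf_pos h m]
  have h1 := tsum_negMulLog_poissonPmf_le h hm
  have h2 : Real.negMulLog (poissonTail lam m) ≤
      ∑' j, Real.negMulLog (poissonPmf lam (j + (m + 1))) := by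
    have h4 : Real.negMulLog (poissonTail lam m) =
        ∑' j, poissonPmf lam (j + (m + 1)) * -Real.log (poissonTail lam m) := by
      rw [tsum_mul_right, Real.negMulLog, neg_mul_comm]
      rfl
    have h5 := (summable_nat_add_iff (m + 1)).2 hS
    have h6 := (summable_poissonPmf_add lam (m + 1)).mul_right (-Real.log (poissonTail lam m))
    rw [h4]
    refine h6.tsum_le_tsum (fun j => ?_) h5
    rw [Real.negMulLog, neg_mul_comm]
    have hp := poissonPmf_pos h (j + (m + 1))
    refine mul_le_mul_of_nonneg_left (neg_le_neg (Real.log_le_log hp ?_)) hp.le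
    exact (summable_poissonPmf_add lam (m + 1)).le_tsum j fun _ _ => (poissonPmf_pos h _).le
  have h3 := Real.negMulLog_nonneg hG0.le hG1
  rw [he, ← hS.sum_add_tsum_nat_add (m + 1), abs_le]
  constructor <;> linarith

lemma integrable_comp_nat {Ω : Type*} [MeasurableSpace Ω] (μ : Measure Ω) [IsFiniteMeasure μ]
    {N : Ω → ℕ} (hN : Measurable N) {b : ℕ} (hb : ∀ ω, N ω ≤ b) (f : ℕ → ℝ) :
    Integrable (fun ω => f (N ω)) μ := by
  refine Integrable.of_bound ((measurable_of_countable f).comp hN).aestronglyMeasurable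
    (∑ j ∈ Finset.range (b + 1), |f j|) (Filter.Eventually.of_forall fun ω => ?_)
  exact Finset.single_le_sum (f := fun j => |f j|) (fun _ _ => abs_nonneg _)
    (Finset.mem_range.2 (Nat.lt_succ_of_le (hb ω)))

lemma abs_integral_mul_le_of_condExp {Ω : Type*} {mΩ : MeasurableSpace Ω} (μ : Measure Ω)
    [IsProbabilityMeasure μ] {𝓕 : MeasurableSpace Ω} (h𝓕 : 𝓕 ≤ mΩ) {Y Z : Ω → ℝ}
    (hY : Integrable Y μ) (hZ : StronglyMeasurable[𝓕] Z) (hYZ : Integrable (fun ω => Y ω * Z ω) μ)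
    {c : ℝ} (hc : ∀ ω, |Z ω| ≤ c) :
    |∫ ω, Y ω * Z ω ∂μ| ≤ (∫ ω, |(μ[Y | 𝓕]) ω| ∂μ) * c := by
  have h1 : ∫ ω, Y ω * Z ω ∂μ = ∫ ω, (μ[Y | 𝓕]) ω * Z ω ∂μ := by
    rw [← integral_condExp h𝓕]
    exact integral_congr_ae (condExp_mul_of_stronglyMeasurable_right hZ hYZ hY)
  rw [h1, ← integral_mul_const]
  refine (abs_integral_le_integral_abs).trans ?_
  refine integral_mono_of_nonneg (Filter.Eventually.of_forall fun _ => abs_nonneg _)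
    (integrable_condExp.abs.mul_const c) (Filter.Eventually.of_forall fun ω => ?_)
  simp only [abs_mul]
  exact mul_le_mul_of_nonneg_left (hc ω) (abs_nonneg _)

/-- The pointwise decomposition behind the Chen-Stein method, for one summand `y ∈ {0, 1}`
with mean `p`, the sum `e` of its neighbours and the sum `v` of the other summands. -/
lemma stein_summand_le {f : ℕ → ℝ} {D p : ℝ} (hp : 0 ≤ p)
    (hf : ∀ k d : ℕ, |f (k + d + 1) - f (k + 1)| ≤ d * D) {y e v : ℕ} (hy : y ≤ 1) :
    p * f (v + e + y + 1) - y * f (v + e + y) ≤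
      D * (p * y + p * e + y * e) - ((y : ℝ) - p) * f (v + 1) := by
  have h1 := mul_le_mul_of_nonneg_left (le_of_abs_le (hf (v + e) y)) hp
  have h2 := abs_le.1 (hf v e)
  have h3 := mul_le_mul_of_nonneg_left h2.2 hp
  interval_cases y
  · norm_num at h1 ⊢
    linarith
  · norm_num at h1 ⊢
    linarith

/-- One-sided form of the Chen-Stein bound of Arratia, Goldstein and Gordon. -/
lemma integral_sub_tsum_poissonPmf_le {Ω : Type*} {mΩ : MeasurableSpace Ω} (μ : Measure Ω)
    [IsProbabilityMeasure μ] {I : Type*} [Fintype I] [DecidableEq I] {Y : I → Ω → ℕ}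
    (hYm : ∀ α, Measurable (Y α)) (hY1 : ∀ α ω, Y α ω ≤ 1) {p : I → ℝ}
    (hp : ∀ α, ∫ ω, (Y α ω : ℝ) ∂μ = p α) {lam : ℝ} (hlam : lam = ∑ α, p α) (hpos : 0 < lam)
    {B : I → Finset I} (hB : ∀ α, α ∈ B α) {𝓕 : I → MeasurableSpace Ω} (h𝓕 : ∀ α, 𝓕 α ≤ mΩ)
    (hY𝓕 : ∀ α, ∀ β ∉ B α, Measurable[𝓕 α] (Y β)) {g : ℕ → ℝ} (g0 : ∀ k, 0 ≤ g k)
    (g1 : ∀ k, g k ≤ 1) :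
    ∫ ω, g (∑ α, Y α ω) ∂μ - ∑' k, g k * poissonPmf lam k ≤
      ((∑ α, ∑ β ∈ B α, p α * p β) +
        ∑ α, ∑ β ∈ (B α).erase α, ∫ ω, (Y α ω : ℝ) * (Y β ω : ℝ) ∂μ) *
          ((1 - Real.exp (-lam)) / lam) +
      (∑ α, ∫ ω, |(μ[(fun ω' => (Y α ω' : ℝ) - p α) | 𝓕 α]) ω| ∂μ) *
        min 1 (1.4 / Real.sqrt lam) := by
  set D := (1 - Real.exp (-lam)) / lam
  set f := steinSol lam g with hf
  have hp0 : ∀ α, 0 ≤ p α := fun α => hp α ▸ integral_nonneg fun ω => Nat.cast_nonneg _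
  have hsumm : ∀ s : Finset I, Measurable fun ω => ∑ α ∈ s, Y α ω := fun s =>
    Finset.measurable_sum s fun α _ => hYm α
  have hsumle : ∀ (s : Finset I) ω, ∑ α ∈ s, Y α ω ≤ s.card := fun s ω => by
    simpa using Finset.sum_le_sum fun α (_ : α ∈ s) => hY1 α ω
  have hYi : ∀ α, Integrable (fun ω => (Y α ω : ℝ)) μ := fun α =>
    integrable_comp_nat μ (hYm α) (hY1 α) (fun k => (k : ℝ))
  have hYmul : ∀ α {φ : Ω → ℝ}, Integrable φ μ → Integrable (fun ω => (Y α ω : ℝ) * φ ω) μ :=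
    fun α φ hφ => hφ.bdd_mul (c := 1) ((measurable_of_countable _).comp (hYm α)).aestronglyMeasurable
      (Filter.Eventually.of_forall fun ω => by
        rw [Real.norm_of_nonneg (Nat.cast_nonneg _)]
        exact_mod_cast hY1 α ω)
  set W : Ω → ℕ := fun ω => ∑ α, Y α ω with hW
  have hfW : ∀ (s : Finset I) (φ : ℕ → ℝ), Integrable (fun ω => φ (∑ α ∈ s, Y α ω)) μ :=
    fun s φ => integrable_comp_nat μ (hsumm s) (hsumle s) φ
  have hleft : ∫ ω, g (W ω) ∂μ - ∑' k, g k * poissonPmf lam k =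
      ∑ α, ∫ ω, (p α * f (W ω + 1) - Y α ω * f (W ω)) ∂μ := by
    rw [← integral_finsetSum]
    · have h1 : ∀ ω, ∑ α, (p α * f (W ω + 1) - Y α ω * f (W ω)) =
          g (W ω) - ∑' k, g k * poissonPmf lam k := fun ω => by
        rw [← steinSol_eq hpos g (W ω), Finset.sum_sub_distrib, ← Finset.sum_mul,
          ← Finset.sum_mul, ← hlam, hW, Nat.cast_sum]
      simp_rw [h1]
      rw [integral_sub (hfW _ g) (integrable_const _)]
      simp [hW]
    · exact fun α _ => ((hfW _ fun k => f (k + 1)).const_mul _).sub (hYmul α (hfW _ f))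
  have hα : ∀ α, ∫ ω, (p α * f (W ω + 1) - Y α ω * f (W ω)) ∂μ ≤
      (∑ β ∈ B α, p α * p β +
        ∑ β ∈ (B α).erase α, ∫ ω, (Y α ω : ℝ) * (Y β ω : ℝ) ∂μ) * D +
      (∫ ω, |(μ[(fun ω' => (Y α ω' : ℝ) - p α) | 𝓕 α]) ω| ∂μ) *
        min 1 (1.4 / Real.sqrt lam) := by
    intro α
    set E : Ω → ℕ := fun ω => ∑ β ∈ (B α).erase α, Y β ω with hE
    set V : Ω → ℕ := fun ω => ∑ β ∈ (B α)ᶜ, Y β ω with hV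
    have hWsplit : ∀ ω, W ω = V ω + E ω + Y α ω := fun ω => by
      simp only [hW, hV, hE]
      rw [add_assoc, Finset.sum_erase_add _ _ (hB α), Finset.sum_compl_add_sum]
    have hVi : Integrable (fun ω => f (V ω + 1)) μ := hfW _ fun k => f (k + 1)
    have hEi : Integrable (fun ω => (E ω : ℝ)) μ := hfW _ fun k => (k : ℝ)
    have hYp : Integrable (fun ω => (Y α ω : ℝ) - p α) μ := (hYi α).sub (integrable_const _)
    have hcross : Integrable (fun ω => ((Y α ω : ℝ) - p α) * f (V ω + 1)) μ := by
      simp_rw [sub_mul]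
      exact (hYmul α hVi).sub (hVi.const_mul _)
    have hcond := abs_integral_mul_le_of_condExp μ (h𝓕 α) hYp
      (Z := fun ω => f (V ω + 1))
      (((measurable_of_countable fun k => f (k + 1)).comp
        (Finset.measurable_sum _ fun β hβ =>
          hY𝓕 α β (Finset.mem_compl.1 hβ))).stronglyMeasurable) hcross
      (fun ω => abs_steinSol_le hpos g0 g1 _)
    have hi1 : Integrable (fun ω => p α * (Y α ω : ℝ) + p α * (E ω : ℝ)) μ :=
      ((hYi α).const_mul (p α)).add (hEi.const_mul (p α))
    have hi2 := hYmul α hEi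
    have hi3 : Integrable (fun ω => D * (p α * (Y α ω : ℝ) + p α * E ω + Y α ω * E ω)) μ :=
      (hi1.add hi2).const_mul D
    calc ∫ ω, (p α * f (W ω + 1) - Y α ω * f (W ω)) ∂μ
        ≤ ∫ ω, (D * (p α * Y α ω + p α * E ω + Y α ω * E ω) -
            ((Y α ω : ℝ) - p α) * f (V ω + 1)) ∂μ := by
          refine integral_mono (((hfW _ fun k => f (k + 1)).const_mul _).sub (hYmul α (hfW _ f)))
            (hi3.sub hcross) fun ω => ?_
          simp only [hWsplit ω]
          exact stein_summand_le (hp0 α) (fun k d => abs_steinSol_add_sub_le hpos g0 g1 k d)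
            (hY1 α ω)
      _ = D * (p α * p α + p α * ∑ β ∈ (B α).erase α, p β +
            ∑ β ∈ (B α).erase α, ∫ ω, (Y α ω : ℝ) * (Y β ω : ℝ) ∂μ) -
            ∫ ω, ((Y α ω : ℝ) - p α) * f (V ω + 1) ∂μ := by
          have e1 : ∫ ω, (E ω : ℝ) ∂μ = ∑ β ∈ (B α).erase α, p β := by
            simp only [hE, Nat.cast_sum]
            rw [integral_finsetSum _ fun β _ => hYi β]
            exact Finset.sum_congr rfl fun β _ => hp β
          have e2 : ∫ ω, (Y α ω : ℝ) * (E ω : ℝ) ∂μ =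
              ∑ β ∈ (B α).erase α, ∫ ω, (Y α ω : ℝ) * (Y β ω : ℝ) ∂μ := by
            simp only [hE, Nat.cast_sum, Finset.mul_sum]
            exact integral_finsetSum _ fun β _ => hYmul α (hYi β)
          rw [integral_sub hi3 hcross, integral_const_mul,
            integral_add hi1 hi2, integral_add ((hYi α).const_mul _) (hEi.const_mul _),
            integral_const_mul, integral_const_mul, hp, e1, e2]
      _ ≤ _ := by
          rw [← Finset.mul_sum, ← Finset.sum_erase_add _ _ (hB α)]
          linarith [(abs_le.1 hcond).1]
  rw [hleft]
  refine (Finset.sum_le_sum fun α _ => hα α).trans (le_of_eq ?_)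
  rw [Finset.sum_add_distrib, ← Finset.sum_mul, ← Finset.sum_mul, Finset.sum_add_distrib]

/-- Poisson approximation of the entropy of a sum of (possibly dependent)
nonnegative, integer-valued and bounded random variables, via the Chen-Stein quantities
`b'1`, `b'2`, `b'3` of the induced Bernoulli random variables `X'_α = 1{X_α = 1}`. -/
theorem entropy_poisson_approx_bounded_integer_valued
    {Ω : Type*} [MeasurableSpace Ω] (μ : Measure Ω) [IsProbabilityMeasure μ]
    {I : Type*} [Fintype I] [DecidableEq I] (n : ℕ) (hcard : Fintype.card I = n)
    (A : ℕ) (X : I → Ω → ℕ) (hXmeas : ∀ α, Measurable (X α)) (hXbdd : ∀ α ω, X α ω ≤ A)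
    (p : I → ℝ) (hp : ∀ α, p α = (μ {ω | X α ω = 1}).toReal)
    (q : I → ℝ) (hq : ∀ α, q α = (μ {ω | 2 ≤ X α ω}).toReal)
    (lam : ℝ) (hlam : lam = ∑ α, p α) (hlampos : 0 < lam)
    (qtot : ℝ) (hqtot : qtot = ∑ α, q α)
    (PW : ℕ → ℝ) (hPW : ∀ k, PW k = (μ {ω | ∑ α, X α ω = k}).toReal)
    (X' : I → Ω → ℕ) (hX' : ∀ α ω, X' α ω = if X α ω = 1 then 1 else 0)
    (B : I → Finset I) (hB : ∀ α, α ∈ B α)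
    (b1' b2' b3' : ℝ)
    (hb1' : b1' = ∑ α, ∑ β ∈ B α, p α * p β)
    (hb2' : b2' = ∑ α, ∑ β ∈ (B α).erase α, ∫ ω, ((X' α ω : ℝ) * (X' β ω : ℝ)) ∂μ)
    (hb3' : b3' = ∑ α, ∫ ω,
        |(μ[(fun ω' => (X' α ω' : ℝ) - p α) |
            ⨆ β ∈ ((Finset.univ : Finset I) \ B α),
              MeasurableSpace.comap (X β) inferInstance]) ω| ∂μ)
    (ηA : ℝ)
    (hηA : ηA = 2 * (b1' + b2') * ((1 - Real.exp (-lam)) / lam) +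
        b3' * min 1 (1.4 / Real.sqrt lam) + qtot)
    (hηA1 : ηA < 1)
    (MA : ℕ) (hMA1 : n * A + 2 ≤ MA) (hMA2 : 1 / (1 - ηA) ≤ (MA : ℝ)) :
    |entropyPmf (poissonPmf lam) - entropyPmf PW| ≤
      ηA * Real.log ((MA : ℝ) - 1) + binEnt ηA + muBound lam (MA : ℝ) := by
  subst hcard
  have hXle : ∀ ω, ∑ α, X α ω ≤ Fintype.card I * A := fun ω => by
    simpa using Finset.sum_le_sum fun α (_ : α ∈ Finset.univ) => hXbdd α ω
  have hX'm : ∀ α, Measurable (X' α) := fun α => by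
    rw [show X' α = (fun k => if k = 1 then 1 else 0) ∘ X α from funext (hX' α)]
    exact (measurable_of_countable _).comp (hXmeas α)
  have hX'1 : ∀ α ω, X' α ω ≤ 1 := fun α ω => by
    rw [hX']; split_ifs <;> simp
  have hsingle : ∀ α, MeasurableSet {ω | X α ω = 1} := fun α =>
    hXmeas α (measurableSet_singleton 1)
  have hlarge : ∀ α, MeasurableSet {ω | 2 ≤ X α ω} := fun α => hXmeas α measurableSet_Ici
  have hWm : Measurable fun ω => ∑ α, X α ω := Finset.measurable_sum _ fun α _ => hXmeas α
  have hpint : ∀ α, ∫ ω, (X' α ω : ℝ) ∂μ = p α := fun α => by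
    rw [hp, ← measureReal_def, ← integral_indicator_one (hsingle α)]
    congr with ω
    simp [hX', Set.indicator_apply]
  have hqint : ∀ α, ∫ ω, (if 2 ≤ X α ω then (1 : ℝ) else 0) ∂μ = q α := fun α => by
    rw [hq, ← measureReal_def, ← integral_indicator_one (hlarge α)]
    congr with ω
    simp [Set.indicator_apply]
  have hPWint : ∀ k, ∫ ω, (if ∑ α, X α ω = k then (1 : ℝ) else 0) ∂μ = PW k := fun k => by
    rw [hPW, ← measureReal_def,
      ← integral_indicator_one (s := {ω | ∑ α, X α ω = k}) (hWm (measurableSet_singleton k))]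
    congr with ω
    simp [Set.indicator_apply]
  have hPW0 : ∀ k, 0 ≤ PW k := fun k => hPW k ▸ ENNReal.toReal_nonneg
  have hPWsum : ∀ S : Finset ℕ, ∑ k ∈ S, PW k =
      ∫ ω, (if ∑ α, X α ω ∈ S then (1 : ℝ) else 0) ∂μ := fun S => by
    rw [← Finset.sum_congr rfl fun k _ => hPWint k, ← integral_finsetSum _ fun k _ =>
      integrable_comp_nat μ hWm hXle fun j => if j = k then (1 : ℝ) else 0]
    simp
  obtain ⟨m, rfl⟩ : ∃ m, MA = m + 2 := ⟨MA - 2, by omega⟩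
  have hm : Fintype.card I * A ≤ m := by omega
  have hPWm : ∀ k, m < k → PW k = 0 := fun k hk => by
    rw [hPW, show {ω | ∑ α, X α ω = k} = ∅ from
      Set.eq_empty_of_forall_notMem fun ω (hω : _ = k) => by have := hXle ω; omega]
    simp
  have hlamm : lam ≤ m := by
    have h1 : ∀ α, p α ≤ A := fun α => by
      rw [← hpint α]
      refine (integral_mono (integrable_comp_nat μ (hX'm α) (hX'1 α) (fun k => (k : ℝ)))
        (integrable_const (A : ℝ)) fun ω => ?_).trans (by simp)
      have : X' α ω ≤ A := by
        have := hXbdd α ω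
        rw [hX']; split_ifs <;> omega
      exact Nat.cast_le.2 this
    calc lam ≤ ∑ _α : I, (A : ℝ) := hlam ▸ Finset.sum_le_sum fun α _ => h1 α
      _ = ((Fintype.card I * A : ℕ) : ℝ) := by simp
      _ ≤ m := by exact_mod_cast hm
  have hm1 : 1 ≤ m := by
    have : (0 : ℝ) < m := hlampos.trans_le hlamm
    exact_mod_cast this
  set Q : ℕ → ℝ := fun k => if k < m + 1 then poissonPmf lam k else poissonTail lam m with hQ
  have hQlt : ∀ k ∈ Finset.range (m + 1), Q k = poissonPmf lam k := fun k hk =>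
    if_pos (Finset.mem_range.1 hk)
  have hQm : Q (m + 1) = poissonTail lam m := if_neg (by omega)
  have hQ0 : ∀ k, 0 ≤ Q k := fun k => by
    simp only [hQ]
    split_ifs
    exacts [(poissonPmf_pos hlampos k).le, (poissonTail_pos hlampos m).le]
  have hb0 : 0 ≤ b1' + b2' := by
    have hp0 : ∀ α, 0 ≤ p α := fun α => hp α ▸ ENNReal.toReal_nonneg
    rw [hb1', hb2']
    exact add_nonneg
      (Finset.sum_nonneg fun α _ => Finset.sum_nonneg fun β _ => mul_nonneg (hp0 α) (hp0 β))
      (Finset.sum_nonneg fun α _ => Finset.sum_nonneg fun β _ =>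
        integral_nonneg fun ω => by positivity)
  have htv : ∀ S : Finset ℕ, ∑ k ∈ S, (PW k - poissonPmf lam k) ≤ ηA := fun S => by
    set g : ℕ → ℝ := fun k => if k ∈ S then 1 else 0 with hg
    have g0 : ∀ k, 0 ≤ g k := fun k => by simp only [hg]; split_ifs <;> simp
    have g1 : ∀ k, g k ≤ 1 := fun k => by simp only [hg]; split_ifs <;> simp
    have hstein := integral_sub_tsum_poissonPmf_le μ hX'm hX'1 hpint hlam hlampos hB
      (𝓕 := fun α => ⨆ β ∈ ((Finset.univ : Finset I) \ B α),
        MeasurableSpace.comap (X β) inferInstance)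
      (fun α => iSup₂_le fun β _ => (hXmeas β).comap_le)
      (fun α β hβ => by
        rw [show X' β = (fun k => if k = 1 then 1 else 0) ∘ X β from funext (hX' β)]
        refine (measurable_of_countable _).comp ((comap_measurable (X β)).mono ?_ le_rfl)
        exact le_iSup₂_of_le β (by simpa using hβ) le_rfl) g0 g1
    rw [← hb1', ← hb2', ← hb3'] at hstein
    have hgsum : ∑' k, g k * poissonPmf lam k = ∑ k ∈ S, poissonPmf lam k := by
      rw [tsum_eq_sum (s := S) fun k hk => by simp [hg, hk]]
      exact Finset.sum_congr rfl fun k hk => by simp [hg, hk]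
    have hle : ∫ ω, g (∑ α, X α ω) ∂μ ≤ ∫ ω, g (∑ α, X' α ω) ∂μ + qtot := by
      have hi1 : Integrable (fun ω => g (∑ α, X' α ω)) μ :=
        integrable_comp_nat μ (Finset.measurable_sum _ fun α _ => hX'm α)
          (fun ω => Finset.sum_le_sum fun α _ => hX'1 α ω) g
      have hi2 : ∀ α, Integrable (fun ω => if 2 ≤ X α ω then (1 : ℝ) else 0) μ := fun α =>
        integrable_comp_nat μ (hXmeas α) (hXbdd α) fun k => if 2 ≤ k then (1 : ℝ) else 0
      have hi3 : Integrable (fun ω => ∑ α, if 2 ≤ X α ω then (1 : ℝ) else 0) μ :=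
        integrable_finsetSum _ fun α _ => hi2 α
      rw [hqtot, ← Finset.sum_congr rfl fun α _ => hqint α,
        ← integral_finsetSum _ fun α _ => hi2 α, ← integral_add hi1 hi3]
      refine integral_mono (integrable_comp_nat μ hWm hXle g) (hi1.add hi3) fun ω => ?_
      have hnn : ∀ α ∈ Finset.univ, 0 ≤ if 2 ≤ X α ω then (1 : ℝ) else 0 := fun α _ => by
        split_ifs <;> simp
      by_cases h : ∃ α, 2 ≤ X α ω
      · obtain ⟨α, hα⟩ := h
        have := Finset.single_le_sum hnn (Finset.mem_univ α)
        rw [if_pos hα] at this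
        beta_reduce
        linarith [g1 (∑ α, X α ω), g0 (∑ α, X' α ω)]
      · push Not at h
        have : ∑ α, X α ω = ∑ α, X' α ω := Finset.sum_congr rfl fun α _ => by
          rw [hX']
          have := h α
          split_ifs <;> omega
        beta_reduce
        rw [this]
        exact le_add_of_nonneg_right (Finset.sum_nonneg hnn)
    have hD0 : 0 ≤ (b1' + b2') * ((1 - Real.exp (-lam)) / lam) :=
      mul_nonneg hb0 (div_nonneg (sub_nonneg.2 (Real.exp_le_one_iff.2 (by linarith))) hlampos.le)
    rw [Finset.sum_sub_distrib, hPWsum, ← hgsum, hηA]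
    change ∫ ω, g (∑ α, X α ω) ∂μ - _ ≤ _
    linarith
  have hmax : ∑ k ∈ Finset.range (m + 2), max (PW k - Q k) 0 ≤ ηA := by
    rw [Finset.sum_range_succ, hQm, hPWm _ (Nat.lt_succ_self m),
      max_eq_right (by linarith [poissonTail_pos hlampos m]), add_zero]
    refine le_trans (le_of_eq ?_)
      (htv ((Finset.range (m + 1)).filter fun k => 0 ≤ PW k - poissonPmf lam k))
    rw [Finset.sum_filter]
    refine Finset.sum_congr rfl fun k hk => ?_
    rw [hQlt k hk]
    split_ifs with h
    · exact max_eq_left h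
    · exact max_eq_right (not_le.1 h).le
  have hPW1 : ∑ k ∈ Finset.range (m + 2), PW k = 1 := by
    rw [hPWsum]
    have : ∀ ω, ∑ α, X α ω ∈ Finset.range (m + 2) := fun ω =>
      Finset.mem_range.2 (by have := hXle ω; omega)
    simp [this]
  have hQ1 : ∑ k ∈ Finset.range (m + 2), Q k = 1 := by
    rw [Finset.sum_range_succ, hQm, Finset.sum_congr rfl hQlt]
    exact poissonCdf_add_poissonTail lam m
  have hfano := abs_sum_negMulLog_sub_le (Finset.range (m + 2)) PW Q (fun k _ => hPW0 k)
    (fun k _ => hQ0 k) hPW1 hQ1 (by simp) hηA1 (by simpa using hMA2) hmax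
  have hHW : entropyPmf PW = ∑ k ∈ Finset.range (m + 2), Real.negMulLog (PW k) := by
    rw [entropyPmf, tsum_eq_sum (s := Finset.range (m + 2)) fun k hk => by
      rw [hPWm k (by simp at hk; omega), zero_mul], ← Finset.sum_neg_distrib]
    exact Finset.sum_congr rfl fun k _ => by rw [Real.negMulLog, neg_mul]
  have hHQ : ∑ k ∈ Finset.range (m + 2), Real.negMulLog (Q k) =
      ∑ k ∈ Finset.range (m + 1), Real.negMulLog (poissonPmf lam k) +
        Real.negMulLog (poissonTail lam m) := by
    rw [Finset.sum_range_succ, hQm, Finset.sum_congr rfl fun k hk => by rw [hQlt k hk]]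
  have htail := abs_entropyPmf_poissonPmf_sub_le hlampos hlamm
  rw [← hHQ] at htail
  rw [← hHW, abs_sub_comm, Finset.card_range] at hfano
  have htri := abs_sub_le (entropyPmf (poissonPmf lam))
    (∑ k ∈ Finset.range (m + 2), Real.negMulLog (Q k)) (entropyPmf PW)
  push_cast at hfano ⊢
  linarith
end

section
/- Let P and Q be probability mass functions on a common countable set X. Then D(P||Q) ≥ log( 1 / (1 − d_TV(P,Q)²) ), i.e., the relative entropy is at least −log(1 − d_TV(P,Q)²) (with the convention that the right-hand side is +∞ when d_TV(P,Q) = 1). -/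
/-- The total variation distance between two probability mass functions. -/
noncomputable def tvDist {α : Type*} (P Q : α → ℝ) : ℝ := (1 / 2) * ∑' x, |P x - Q x|

open Classical in
/-- The relative entropy `D(P‖Q) ∈ [0,∞]` between two probability mass functions:
it equals `∑ₓ P(x) log(P(x)/Q(x))` when `P` is absolutely continuous w.r.t. `Q` and this
series of nonnegative-corrected terms converges, and `+∞` otherwise.  (Note that for
probability mass functions `∑ₓ (Q(x) - P(x)) = 0`, and the summand
`P(x) log(P(x)/Q(x)) - P(x) + Q(x)` is pointwise nonnegative.) -/
noncomputable def klDivENN {α : Type*} (P Q : α → ℝ) : ENNReal :=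
  if ∀ x, Q x = 0 → P x = 0 then
    ∑' x, ENNReal.ofReal (P x * Real.log (P x / Q x) - P x + Q x)
  else ⊤

/-- The real part of a convergent series is bounded by the extended nonnegative sum of its
positive parts. -/
lemma ofReal_tsum_le_tsum_ofReal {α : Type*} {g : α → ℝ} (hg : Summable g) :
    ENNReal.ofReal (∑' x, g x) ≤ ∑' x, ENNReal.ofReal (g x) := by
  have hpos : Summable fun x => max (g x) 0 := by
    refine Summable.of_nonneg_of_le (fun x => le_max_right _ _) (fun x => ?_) hg.abs
    exact max_le (le_abs_self _) (abs_nonneg _)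
  calc ENNReal.ofReal (∑' x, g x) ≤ ENNReal.ofReal (∑' x, max (g x) 0) :=
        ENNReal.ofReal_le_ofReal (hg.tsum_le_tsum (fun x => le_max_left _ _) hpos)
    _ = ∑' x, ENNReal.ofReal (max (g x) 0) :=
        ENNReal.ofReal_tsum_of_nonneg (fun x => le_max_right _ _) hpos
    _ = ∑' x, ENNReal.ofReal (g x) := by simp [ENNReal.ofReal_max]

/-- The Cauchy-Schwarz inequality for series. -/
lemma sq_tsum_mul_le_of_hasSum {α : Type*} {f g : α → ℝ} {A B S : ℝ}
    (hf : HasSum (fun x => f x ^ 2) A) (hg : HasSum (fun x => g x ^ 2) B)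
    (hfg : HasSum (fun x => f x * g x) S) : S ^ 2 ≤ A * B := by
  have hdisc : discrim A (2 * S) B ≤ 0 := by
    refine discrim_le_zero fun t => ?_
    have hsum := ((hf.mul_right (t * t)).add ((hfg.mul_left 2).mul_right t)).add hg
    refine hsum.nonneg fun x => ?_
    nlinarith [sq_nonneg (f x * t + g x)]
  rw [discrim] at hdisc
  linarith

lemma summable_sqrt_mul {α : Type*} {P Q : α → ℝ} (hP : ∀ x, 0 ≤ P x) (hQ : ∀ x, 0 ≤ Q x)
    (hPs : Summable P) (hQs : Summable Q) : Summable fun x => √(P x) * √(Q x) := by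
  refine Summable.of_nonneg_of_le (fun x => by positivity) (fun x => ?_) (hPs.add hQs)
  nlinarith [sq_nonneg (√(P x) - √(Q x)), Real.sq_sqrt (hP x), Real.sq_sqrt (hQ x), hP x, hQ x]

/-- The total variation distance is controlled by the Bhattacharyya coefficient. -/
lemma tvDist_sq_add_bhattacharyya_sq_le_one {α : Type*} {P Q : α → ℝ}
    (hP : ∀ x, 0 ≤ P x) (hQ : ∀ x, 0 ≤ Q x) (hPs : HasSum P 1) (hQs : HasSum Q 1) :
    tvDist P Q ^ 2 + (∑' x, √(P x) * √(Q x)) ^ 2 ≤ 1 := by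
  have hB := (summable_sqrt_mul hP hQ hPs.summable hQs.summable).hasSum
  set B := ∑' x, √(P x) * √(Q x)
  have hminus : HasSum (fun x => |√(P x) - √(Q x)| ^ 2) (1 + 1 - 2 * B) := by
    refine ((hPs.add hQs).sub (hB.mul_left 2)).congr_fun fun x => ?_
    rw [sq_abs]
    linear_combination Real.sq_sqrt (hP x) + Real.sq_sqrt (hQ x)
  have hplus : HasSum (fun x => (√(P x) + √(Q x)) ^ 2) (1 + 1 + 2 * B) := by
    refine ((hPs.add hQs).add (hB.mul_left 2)).congr_fun fun x => ?_
    linear_combination Real.sq_sqrt (hP x) + Real.sq_sqrt (hQ x)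
  have hprod : HasSum (fun x => |√(P x) - √(Q x)| * (√(P x) + √(Q x))) (∑' x, |P x - Q x|) := by
    refine (hPs.summable.sub hQs.summable).abs.hasSum.congr_fun fun x => ?_
    rw [← abs_of_nonneg (by positivity : 0 ≤ √(P x) + √(Q x)), ← abs_mul]
    congr 1
    linear_combination Real.sq_sqrt (hP x) - Real.sq_sqrt (hQ x)
  have hcs := sq_tsum_mul_le_of_hasSum hminus hplus hprod
  rw [tvDist]
  nlinarith

/-- A pointwise lower bound for the corrected entropy summand, tangent at `√(q / p) = c`. -/
lemma tangent_le_mul_log_div {p q c : ℝ} (hp : 0 ≤ p) (hq : 0 ≤ q) (hpq : q = 0 → p = 0)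
    (hc : 0 < c) :
    p + q - 2 * Real.log c * p - 2 / c * (√p * √q) ≤ p * Real.log (p / q) - p + q := by
  rcases hp.eq_or_lt with rfl | hp
  · simp
  have hq : 0 < q := hq.lt_of_ne fun h => hp.ne' (hpq h.symm)
  have hsp := Real.sqrt_pos.2 hp
  have hsq := Real.sqrt_pos.2 hq
  have hlog := Real.log_le_sub_one_of_pos (show 0 < √q / (√p * c) by positivity)
  rw [Real.log_div hsq.ne' (by positivity), Real.log_mul hsp.ne' hc.ne',
    Real.log_sqrt hq.le, Real.log_sqrt hp.le] at hlog
  have hmul := mul_le_mul_of_nonneg_left hlog hp.le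
  have heq : p * (√q / (√p * c)) = 1 / c * (√p * √q) := by
    field_simp
    rw [Real.sq_sqrt hp.le]
  rw [Real.log_div hp.ne' hq.ne']
  rw [mul_sub p (√q / (√p * c)), heq] at hmul
  have : 2 / c * (√p * √q) = 2 * (1 / c * (√p * √q)) := by ring
  linarith

open Classical in
/-- For probability mass functions `P, Q` on a common countable set,
`D(P‖Q) ≥ log(1/(1 - d_TV(P,Q)²))`, with the convention that the right-hand side is `+∞`
when `d_TV(P,Q) = 1`. -/
theorem kl_lower_bound_of_tv
    {𝓧 : Type*} [Countable 𝓧] (P Q : 𝓧 → ℝ)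
    (hPnn : ∀ x, 0 ≤ P x) (hPsum : ∑' x, P x = 1)
    (hQnn : ∀ x, 0 ≤ Q x) (hQsum : ∑' x, Q x = 1) :
    (if tvDist P Q = 1 then (⊤ : ENNReal)
      else ENNReal.ofReal (Real.log (1 / (1 - tvDist P Q ^ 2)))) ≤ klDivENN P Q := by
  have hPs : Summable P := by
    by_contra h
    simp [tsum_eq_zero_of_not_summable h] at hPsum
  have hQs : Summable Q := by
    by_contra h
    simp [tsum_eq_zero_of_not_summable h] at hQsum
  have hP : HasSum P 1 := hPsum ▸ hPs.hasSum
  have hQ : HasSum Q 1 := hQsum ▸ hQs.hasSum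
  rw [klDivENN]
  by_cases hac : ∀ x, Q x = 0 → P x = 0
  swap
  · simp [hac]
  rw [if_pos hac]
  have hBs := summable_sqrt_mul hPnn hQnn hPs hQs
  have hTV := tvDist_sq_add_bhattacharyya_sq_le_one hPnn hQnn hP hQ
  have hBpos : 0 < ∑' x, √(P x) * √(Q x) := by
    obtain ⟨x, hx⟩ : ∃ x, P x ≠ 0 := by
      by_contra! h
      simp [h] at hPsum
    have hPx : 0 < P x := (hPnn x).lt_of_ne hx.symm
    have hQx : 0 < Q x := (hQnn x).lt_of_ne fun h => hx (hac x h.symm)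
    exact hBs.tsum_pos (fun y => by positivity) x (by positivity)
  set B := ∑' x, √(P x) * √(Q x)
  have hBsq : 0 < B ^ 2 := by positivity
  rw [if_neg fun h => by rw [h] at hTV; linarith]
  have hsum : HasSum (fun x => P x + Q x - 2 * Real.log B * P x - 2 / B * (√(P x) * √(Q x)))
      (-(2 * Real.log B)) := by
    have h := ((hP.add hQ).sub (hP.mul_left (2 * Real.log B))).sub (hBs.hasSum.mul_left (2 / B))
    rwa [show 1 + 1 - 2 * Real.log B * 1 - 2 / B * B = -(2 * Real.log B) by
      rw [div_mul_cancel₀ 2 hBpos.ne']; ring] at h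
  have hlog : Real.log (1 / (1 - tvDist P Q ^ 2)) ≤ -(2 * Real.log B) := by
    have hle := Real.log_le_log hBsq (by linarith : B ^ 2 ≤ 1 - tvDist P Q ^ 2)
    rw [Real.log_pow] at hle
    rw [one_div, Real.log_inv]
    push_cast at hle
    linarith
  calc ENNReal.ofReal (Real.log (1 / (1 - tvDist P Q ^ 2)))
      ≤ ENNReal.ofReal (∑' x, (P x + Q x - 2 * Real.log B * P x
          - 2 / B * (√(P x) * √(Q x)))) :=
        ENNReal.ofReal_le_ofReal (hsum.tsum_eq.symm ▸ hlog)
    _ ≤ ∑' x, ENNReal.ofReal (P x + Q x - 2 * Real.log B * P x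
          - 2 / B * (√(P x) * √(Q x))) := ofReal_tsum_le_tsum_ofReal hsum.summable
    _ ≤ ∑' x, ENNReal.ofReal (P x * Real.log (P x / Q x) - P x + Q x) :=
        ENNReal.tsum_le_tsum fun x => ENNReal.ofReal_le_ofReal
          (tangent_le_mul_log_div (hPnn x) (hQnn x) (hac x) hBpos)
end
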